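/- Let k ≥ 3 be an integer and β ∈ (k−1, k). Then DF(β) is a compact convex subset of Δ of dimension k−1, i.e. its affine hull is the hyperplane {x ∈ ℝ^k : x_0 + ⋯ + x_{k−1} = 1}. -/

import Mathlib

open Filter Topology
open scoped Classical

namespace BetaDF

/-- Digit sequences (elements of `Σ = {0,…,k−1}^ℕ` when all entries are `< k`). -/
abbrev Seq : Type := ℕ → ℕ

/-- Lexicographic (strict) order on digit sequences. -/
def seqLt (v w : Seq) : Prop := ∃ r, (∀ s, s < r → v s = w s) ∧ v r < w r

/-- Lexicographic order on digit sequences. -/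
def seqLe (v w : Seq) : Prop := seqLt v w ∨ v = w

/-- The shift map `σ`. -/
def shift (w : Seq) : Seq := fun r => w (r + 1)

/-- Membership in `Σ = {0,…,k−1}^ℕ`. -/
def InSigma (k : ℕ) (w : Seq) : Prop := ∀ r, w r < k

/-- A sequence is maximal if it is `≥` every element of its shift orbit. -/
def IsMaximal (w : Seq) : Prop := ∀ r, seqLe (shift^[r] w) w

/-- Number of occurrences of the digit `i` among the first `r` entries of `w`. -/
def digitCount (w : Seq) (i r : ℕ) : ℕ := ((Finset.range r).filter fun s => w s = i).card

/-- The ambient Euclidean space `ℝ^k`. -/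
abbrev E (k : ℕ) : Type := EuclideanSpace ℝ (Fin k)

/-- The `i`-th coordinate (with junk value `0` for `i ≥ k`). -/
def proj {k : ℕ} (α : E k) (i : ℕ) : ℝ := if h : i < k then α ⟨i, h⟩ else 0

/-- `w` has digit frequency vector `α`. -/
def HasDigitFreq (k : ℕ) (w : Seq) (α : E k) : Prop :=
  ∀ i, i < k →
    Tendsto (fun r => (digitCount w i r : ℝ) / (r : ℝ)) atTop (𝓝 (proj α i))

/-- The standard `(k−1)`-simplex `Δ`. -/
def simplex (k : ℕ) : Set (E k) := {α | (∀ i : Fin k, 0 ≤ α i) ∧ ∑ i, α i = 1}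

/-- The face `F = {α ∈ Δ : α_{k−1} = 0}`. -/
def faceF (k : ℕ) : Set (E k) := {α ∈ simplex k | proj α (k - 1) = 0}

/-- `Δ' = Δ ∖ F`. -/
def simplex' (k : ℕ) : Set (E k) := simplex k \ faceF k

/-- `J(α) = ⌊α₀/α_{k−1}⌋`. -/
noncomputable def Jfun {k : ℕ} (α : E k) : ℕ := ⌊proj α 0 / proj α (k - 1)⌋₊

/-- The map `K_n`. -/
noncomputable def Kmap {k : ℕ} (n : ℕ) (α : E k) : E k :=
  (WithLp.equiv 2 (Fin k → ℝ)).symm fun i =>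
    if (i : ℕ) + 2 < k then proj α ((i : ℕ) + 1) / (1 - proj α 0)
    else if (i : ℕ) + 2 = k then (proj α 0 - n * proj α (k - 1)) / (1 - proj α 0)
    else ((n + 1) * proj α (k - 1) - proj α 0) / (1 - proj α 0)

/-- The continued-fraction map `K : Δ' → Δ'`, `K(α) = K_{J(α)}(α)`. -/
noncomputable def Kstep {k : ℕ} (α : E k) : E k := Kmap (Jfun α) α

/-- The itinerary map `Φ(α)_r = J(K^r(α))`. -/
noncomputable def Phi {k : ℕ} (α : E k) : ℕ → ℕ := fun r => Jfun (Kstep^[r] α)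

/-- The projective embedding `K_n^{-1} : Δ → Δ`. -/
noncomputable def Kinv {k : ℕ} (n : ℕ) (α : E k) : E k :=
  (WithLp.equiv 2 (Fin k → ℝ)).symm fun i =>
    (if (i : ℕ) = 0 then (n + 1) * proj α (k - 2) + n * proj α (k - 1)
      else if (i : ℕ) + 1 = k then proj α (k - 2) + proj α (k - 1)
      else proj α ((i : ℕ) - 1)) /
      ((n + 1) * proj α (k - 2) + n * proj α (k - 1) + 1)

/-- `Υ_{n,r} = K_{n₀}^{-1} ∘ ⋯ ∘ K_{n_r}^{-1}`. -/
noncomputable def Ups {k : ℕ} (n : ℕ → ℕ) : ℕ → E k → E k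
  | 0 => Kinv (n 0)
  | r + 1 => fun α => Ups n r (Kinv (n (r + 1)) α)

/-- `A_{n,r} = Υ_{n,r}(Δ)`. -/
noncomputable def Anr (k : ℕ) (n : ℕ → ℕ) (r : ℕ) : Set (E k) := Ups n r '' simplex k

/-- `F_{n,r} = Υ_{n,r}(F)`. -/
noncomputable def Fnr (k : ℕ) (n : ℕ → ℕ) (r : ℕ) : Set (E k) := Ups n r '' faceF k

/-- Reverse-lexicographic strict order on `ℕ^ℕ`: `a < b` iff `a` exceeds `b`
at the first index where they differ. -/
def revLexLt (a b : ℕ → ℕ) : Prop := ∃ r, (∀ s, s < r → a s = b s) ∧ b r < a r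

/-- The word to which the substitution `Λ_n` sends the digit `i`. -/
def lamWord (k n i : ℕ) : List ℕ :=
  if i + 2 < k then [i + 1]
  else if i + 2 = k then (k - 1) :: List.replicate (n + 1) 0
  else (k - 1) :: List.replicate n 0

/-- The substitution `Λ_n : Σ → Σ`. -/
def lamSub (k n : ℕ) (w : Seq) : Seq := fun m =>
  (((List.range (m + 1)).map fun r => lamWord k n (w r)).flatten).getD m 0

/-- `Λ_{n,r} = Λ_{n₀} ∘ ⋯ ∘ Λ_{n_r}`. -/
def lamChain (k : ℕ) (n : ℕ → ℕ) : ℕ → Seq → Seq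
  | 0 => lamSub k (n 0)
  | r + 1 => fun w => lamChain k n r (lamSub k (n (r + 1)) w)

/-- `Λ_{n₀} ∘ ⋯ ∘ Λ_{n_{R−1}}` for a finite list of indices. -/
def lamList (k : ℕ) : List ℕ → Seq → Seq
  | [], w => w
  | a :: t, w => lamSub k a (lamList k t w)

/-- The constant sequence `(k−1)(k−1)(k−1)…`. -/
def topSeq (k : ℕ) : Seq := fun _ => k - 1

/-- The sequence `(k−1)000…`. -/
def baseSeq (k : ℕ) : Seq := fun m => if m = 0 then k - 1 else 0

/-- `S(n) = lim_{r→∞} Λ_{n,r}((k−1)(k−1)(k−1)…)` (limit in the product topology). -/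
noncomputable def Sseq (k : ℕ) (n : ℕ → ℕ) : Seq :=
  limUnder atTop fun r => lamChain k n r (topSeq k)

/-- The compactified itinerary space `N`: sequences with values in `ℕ∞` such that
all entries from the first `∞` onwards equal `∞`.  Elements with no `∞` entry
correspond to `ℕ^ℕ`; the others are the finite type elements `n₀…n_{R−1}∞`. -/
def NN : Type := {m : ℕ → ℕ∞ // ∀ r, m r = ⊤ → m (r + 1) = ⊤}

/-- Reverse-lexicographic strict order on `N` (`∞` counts as larger than every natural). -/
def nnLt (m n : NN) : Prop := ∃ r, (∀ s, s < r → m.1 s = n.1 s) ∧ n.1 r < m.1 r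

/-- Reverse-lexicographic order on `N`. -/
def nnLe (m n : NN) : Prop := nnLt m n ∨ m = n

/-- The element of `N` determined by an element of `ℕ^ℕ`. -/
def toNN (g : ℕ → ℕ) : NN := ⟨fun r => (g r : ℕ∞), fun r h => absurd h (by simp)⟩

/-- The itinerary `n₀ … n_{R−1} (n_R + 1) 0 0 0 …` (of rational type). -/
def ratSeq (f : ℕ → ℕ) (R : ℕ) : ℕ → ℕ := fun r =>
  if r < R then f r else if r = R then f R + 1 else 0

/-- The finite type element `n₀ … n_{R−1} n_R ∞` of `N`. -/
def finNN (f : ℕ → ℕ) (R : ℕ) : NN :=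
  ⟨fun r => if r ≤ R then (f r : ℕ∞) else ⊤, by
    intro r h
    show (if r + 1 ≤ R then ((f (r + 1) : ℕ∞)) else ⊤) = ⊤
    have h' : (if r ≤ R then ((f r : ℕ∞)) else ⊤) = ⊤ := h
    by_cases h1 : r ≤ R
    · rw [if_pos h1] at h'
      exact absurd h' (by simp)
    · rw [if_neg (by omega : ¬ r + 1 ≤ R)]⟩

/-- The extension of `S` to `N`. -/
noncomputable def SN (k : ℕ) (m : NN) : Seq :=
  if h : ∃ R, m.1 R = ⊤ then
    lamList k ((List.range (Nat.find h)).map fun r => (m.1 r).toNat) (baseSeq k)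
  else Sseq k fun r => (m.1 r).toNat

/-- The metric `d(m,n) = 2^{−X(m,n)}` on `N`, where
`X(m,n) = r + min(m₀+⋯+m_r, n₀+⋯+n_r)` and `r` is the first index where `m,n` differ. -/
noncomputable def dN (m n : NN) : ℝ :=
  if h : m = n then 0
  else
    have hex : ∃ r, m.1 r ≠ n.1 r := by
      by_contra hc
      push_neg at hc
      exact h (Subtype.ext (funext hc))
    (2 : ℝ) ^ (-(((Nat.find hex : ℕ) : ℤ) +
      ((min (∑ s ∈ Finset.range (Nat.find hex + 1), m.1 s)
            (∑ s ∈ Finset.range (Nat.find hex + 1), n.1 s)).toNat : ℤ)))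

/-- The symbolic β-shift `X(w)`. -/
def Xset (k : ℕ) (w : Seq) : Set Seq :=
  {v | InSigma k v ∧ ∀ r, seqLe (shift^[r] v) w}

/-- The digit frequency set `DF(w)` of the symbolic β-shift `X(w)`. -/
def DFw (k : ℕ) (w : Seq) : Set (E k) :=
  {α | α ∈ simplex k ∧ ∃ v ∈ Xset k w, HasDigitFreq k v α}

/-- `DF(n) = DF(S(n))` for `n ∈ ℕ^ℕ`. -/
noncomputable def DFn (k : ℕ) (n : ℕ → ℕ) : Set (E k) := DFw k (Sseq k n)

/-- `DF(n) = DF(S(n))` for `n ∈ N`. -/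
noncomputable def DFN (k : ℕ) (m : NN) : Set (E k) := DFw k (SN k m)

/-- The infimax map `I = S ∘ Φ` on `Δ'`, extended by `I(α) = (k−1)000…` on `F`. -/
noncomputable def Ifun (k : ℕ) (α : E k) : Seq :=
  if α ∈ simplex' k then Sseq k (Phi α) else baseSeq k

/-- The simplex `T_m = {α ∈ Δ : (m+1)α_{k−1} ≤ α₀}`. -/
def Tset (k m : ℕ) : Set (E k) :=
  {α ∈ simplex k | ((m : ℝ) + 1) * proj α (k - 1) ≤ proj α 0}

/-- The standard basis vector `e_i`. -/
noncomputable def evec (k i : ℕ) : E k :=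
  (WithLp.equiv 2 (Fin k → ℝ)).symm fun j => if (j : ℕ) = i then 1 else 0

/-- The rational extreme points
`FE(n) = {Υ_{n,s}(e_{k−2}) : n_{s+t} ≠ 0 for some 1 ≤ t ≤ k−2}`. -/
noncomputable def FEset (k : ℕ) (n : ℕ → ℕ) : Set (E k) :=
  {α | ∃ s, (∃ t, 1 ≤ t ∧ t ≤ k - 2 ∧ n (s + t) ≠ 0) ∧ α = Ups n s (evec k (k - 2))}

/-- The set `E(n)` of non-trivial extreme points of `DF(n)`:
extreme points other than `e₀,…,e_{k−2}`. -/
noncomputable def Eset (k : ℕ) (n : ℕ → ℕ) : Set (E k) :=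
  Set.extremePoints ℝ (DFn k n) \ {α | ∃ i, i ≤ k - 2 ∧ α = evec k i}

/-- The fiber `Φ^{-1}(n) ⊆ Δ'`. -/
noncomputable def PhiFiber (k : ℕ) (n : ℕ → ℕ) : Set (E k) :=
  {α ∈ simplex' k | Phi α = n}

/-- `f_β(x) = βx mod 1`. -/
noncomputable def fbeta (β x : ℝ) : ℝ := Int.fract (β * x)

/-- The digit sequence of the greedy β-expansion of `x`: `d_β(x)_r = ⌊β f_β^r(x)⌋`. -/
noncomputable def dbeta (β : ℝ) (x : ℝ) : Seq := fun r => ⌊β * (fbeta β)^[r] x⌋₊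

/-- The digit frequency set `DF(β)` of β-expansions of points of `[0,1]`. -/
noncomputable def DFbeta (k : ℕ) (β : ℝ) : Set (E k) :=
  {α | α ∈ simplex k ∧ ∃ x ∈ Set.Icc (0 : ℝ) 1, HasDigitFreq k (dbeta β x) α}

/-- The sequence `w_β`: if `d_β(1) = d₁…d_{r−1}d_r000…` with `d_r > 0` then `w_β`
is the infinite repetition of `d₁…d_{r−1}(d_r − 1)`; otherwise `w_β = d_β(1)`. -/
noncomputable def wbeta (β : ℝ) : Seq :=
  if h : ∃ r, dbeta β 1 r ≠ 0 ∧ ∀ s, r < s → dbeta β 1 s = 0 then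
    fun m =>
      if m % (Nat.find h + 1) = Nat.find h then dbeta β 1 (Nat.find h) - 1
      else dbeta β 1 (m % (Nat.find h + 1))
  else dbeta β 1

/-- `DF` extended to `[k−1,k]` by `DF(k−1) = F` and `DF(k) = Δ`. -/
noncomputable def DFext (k : ℕ) (β : ℝ) : Set (E k) :=
  if β ≤ (k : ℝ) - 1 then faceF k
  else if (k : ℝ) ≤ β then simplex k
  else DFbeta k β

/-- The mode-locking interval `I_{n₀…n_R}` determined by the word `f 0, …, f R`. -/
noncomputable def Iint (k : ℕ) (f : ℕ → ℕ) (R : ℕ) : Set ℝ :=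
  {β | (k : ℝ) - 1 < β ∧ β < k ∧
    seqLe (Sseq k (ratSeq f R)) (wbeta β) ∧ seqLe (wbeta β) (SN k (finNN f R))}

/-- The frequency vector of the first `s` digits of `w`. -/
noncomputable def freqVec (k : ℕ) (w : Seq) (s : ℕ) : E k :=
  (WithLp.equiv 2 (Fin k → ℝ)).symm fun i => (digitCount w (i : ℕ) s : ℝ) / (s : ℝ)


/-! ### Evaluation of finite words and good words -/

/-- Evaluation of a finite word in base `β` with remainder `t`. -/
noncomputable def ev (β t : ℝ) : List ℕ → ℝ
  | [] => t
  | a :: l => ((a : ℝ) + ev β t l) / β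

/-- Words all of whose nonempty suffixes have `ev β 1 < 1`; they concatenate freely. -/
def Good (β : ℝ) : List ℕ → Prop
  | [] => True
  | a :: l => ((a : ℝ) + ev β 1 l) / β < 1 ∧ Good β l

/-- Words all of whose nonempty suffixes have `ev β 0 < 1`. -/
def Adm (β : ℝ) : List ℕ → Prop
  | [] => True
  | a :: l => ((a : ℝ) + ev β 0 l) / β < 1 ∧ Adm β l

/-- The subword of `v` of length `n` starting at `r`. -/
def window (v : Seq) (r n : ℕ) : List ℕ := (List.range' r n).map v

lemma window_zero (v : Seq) (r : ℕ) : window v r 0 = [] := rfl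

lemma window_succ (v : Seq) (r n : ℕ) : window v r (n + 1) = v r :: window v (r + 1) n := rfl

lemma window_length (v : Seq) (r n : ℕ) : (window v r n).length = n := by simp [window]

lemma window_add (v : Seq) (r m n : ℕ) :
    window v r (m + n) = window v r m ++ window v (r + m) n := by
  induction m generalizing r with
  | zero => simp [window_zero]
  | succ m ih =>
    rw [show m + 1 + n = (m + n) + 1 by ring, window_succ, window_succ, ih,
      show r + 1 + m = r + (m + 1) by ring]
    rfl

lemma count_window (v : Seq) (i r : ℕ) : (window v 0 r).count i = digitCount v i r := by
  induction r with
  | zero => simp [window, digitCount]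
  | succ r ih =>
    rw [window_add, List.count_append, ih]
    unfold digitCount
    rw [Finset.range_add_one, Finset.filter_insert]
    by_cases h : v r = i
    · rw [if_pos h, Finset.card_insert_of_notMem (by simp)]
      simp [window, h]
    · rw [if_neg h]
      simp [window, h]

lemma ev_nonneg {β t : ℝ} (hβ : 1 < β) (ht : 0 ≤ t) (l : List ℕ) : 0 ≤ ev β t l := by
  induction l with
  | nil => exact ht
  | cons a l ih => exact div_nonneg (add_nonneg (Nat.cast_nonneg _) ih) (by linarith)

lemma ev_mono {β s t : ℝ} (hβ : 1 < β) (h : s ≤ t) (l : List ℕ) : ev β s l ≤ ev β t l := by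
  induction l with
  | nil => exact h
  | cons a l ih =>
    have : 0 < β := by linarith
    simp only [ev]
    gcongr

lemma ev_append (β t : ℝ) (u v : List ℕ) : ev β t (u ++ v) = ev β (ev β t v) u := by
  induction u with
  | nil => rfl
  | cons a l ih => simp only [List.cons_append, ev, ih]

lemma ev_eq {β : ℝ} (t : ℝ) (l : List ℕ) :
    ev β t l = ev β 0 l + t * β⁻¹ ^ l.length := by
  induction l with
  | nil => simp [ev]
  | cons a l ih => simp only [ev, ih, List.length_cons, pow_succ, div_eq_mul_inv]; ring

lemma Good.ev_le {β : ℝ} {l : List ℕ} (h : Good β l) : ev β 1 l ≤ 1 := by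
  cases l with
  | nil => exact le_refl _
  | cons a l => exact h.1.le

lemma Good.append {β : ℝ} (hβ : 1 < β) {u v : List ℕ} (hu : Good β u) (hv : Good β v) :
    Good β (u ++ v) := by
  induction u with
  | nil => exact hv
  | cons a l ih =>
    refine ⟨lt_of_le_of_lt ?_ hu.1, ih hu.2⟩
    change ((a : ℝ) + ev β 1 (l ++ v)) / β ≤ _
    rw [ev_append]
    have : 0 < β := by linarith
    have := ev_mono hβ hv.ev_le l
    gcongr

lemma Good.right {β : ℝ} {u v : List ℕ} (h : Good β (u ++ v)) : Good β v := by
  induction u with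
  | nil => exact h
  | cons a l ih => exact ih h.2

lemma good_zeros {β : ℝ} (hβ : 1 < β) (n : ℕ) : Good β (List.replicate n 0) := by
  induction n with
  | zero => trivial
  | succ n ih =>
    refine ⟨?_, ih⟩
    have := ih.ev_le
    rw [div_lt_one (by linarith)]
    push_cast
    linarith

lemma Good.rep {β : ℝ} (hβ : 1 < β) {u : List ℕ} (hu : Good β u) (a : ℕ) :
    ∃ u', Good β u' ∧ u'.length = a * u.length ∧ ∀ i, u'.count i = a * u.count i := by
  induction a with
  | zero => exact ⟨[], trivial, by simp, by simp⟩
  | succ a ih =>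
    obtain ⟨u', h1, h2, h3⟩ := ih
    exact ⟨u' ++ u, h1.append hβ hu, by simp [h2]; ring, fun i => by simp [h3]; ring⟩

/-- Lowering the last nonzero digit of an admissible word makes it good. -/
lemma adm_to_good {β : ℝ} (hβ : 1 < β) (l : List ℕ) (h : Adm β l) :
    l = List.replicate l.length 0 ∨
    ∃ l', Good β l' ∧ l'.length = l.length ∧ ev β 1 l' ≤ ev β 0 l ∧
      ∀ i, |(l'.count i : ℝ) - l.count i| ≤ 1 := by
  have hβ0 : 0 < β := by linarith
  induction l with
  | nil => left; rfl
  | cons a l ih =>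
    rcases ih h.2 with h0 | ⟨l', g1, g2, g3, g4⟩
    · rcases a with _ | b
      · left
        rw [List.length_cons, List.replicate_succ, ← h0]
      · right
        have hg : Good β l := by rw [h0]; exact good_zeros hβ _
        have hle : ev β 1 (b :: l) ≤ ev β 0 ((b + 1) :: l) := by
          have h3 := hg.ev_le
          have h4 := ev_nonneg hβ le_rfl l
          simp only [ev]
          push_cast
          gcongr ?_ / β
          linarith
        refine ⟨b :: l, ⟨lt_of_le_of_lt hle h.1, hg⟩, by simp, hle, fun i => ?_⟩
        simp only [List.count_cons]
        push_cast
        rw [abs_le]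
        split_ifs <;> constructor <;> norm_num
    · right
      have hle : ev β 1 (a :: l') ≤ ev β 0 (a :: l) := by
        simp only [ev]
        gcongr
      refine ⟨a :: l', ⟨lt_of_le_of_lt hle h.1, g1⟩, by simp [g2], hle, fun i => ?_⟩
      simp only [List.count_cons]
      push_cast
      have := g4 i
      rwa [add_sub_add_right_eq_sub]

lemma adm_to_good' {β : ℝ} (hβ : 1 < β) (l : List ℕ) (h : Adm β l) :
    ∃ l', Good β l' ∧ l'.length = l.length ∧ ∀ i, |(l'.count i : ℝ) - l.count i| ≤ 1 := by
  rcases adm_to_good hβ l h with h0 | ⟨l', g1, g2, _, g4⟩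
  · exact ⟨l, by rw [h0]; exact good_zeros hβ _, rfl, fun i => by simp⟩
  · exact ⟨l', g1, g2, g4⟩

/-! ### Words of β-expansions are admissible -/

lemma fbeta_step {β x : ℝ} (hβ : 1 < β) (hx : 0 ≤ x) :
    β * x = (⌊β * x⌋₊ : ℝ) + fbeta β x := by
  have h : 0 ≤ β * x := by positivity
  unfold fbeta
  rw [natCast_floor_eq_intCast_floor h]
  exact (Int.floor_add_fract _).symm

lemma iter_nonneg {β x : ℝ} (hx : 0 ≤ x) (r : ℕ) : 0 ≤ (fbeta β)^[r] x := by
  cases r with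
  | zero => exact hx
  | succ r => rw [Function.iterate_succ_apply']; exact Int.fract_nonneg _

lemma ev_dbeta {β x : ℝ} (hβ : 1 < β) (hx : 0 ≤ x) (r n : ℕ) :
    (fbeta β)^[r] x = ev β ((fbeta β)^[r + n] x) (window (dbeta β x) r n) := by
  induction n generalizing r with
  | zero => rfl
  | succ n ih =>
    rw [window_succ]
    simp only [ev]
    rw [show r + (n + 1) = r + 1 + n by ring, ← ih, eq_div_iff (by linarith), mul_comm,
      Function.iterate_succ_apply']
    exact fbeta_step hβ (iter_nonneg hx r)

lemma adm_dbeta {β x : ℝ} (hβ : 1 < β) (hx : 0 ≤ x) (r n : ℕ) :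
    Adm β (window (dbeta β x) (r + 1) n) := by
  induction n generalizing r with
  | zero => trivial
  | succ n ih =>
    rw [window_succ]
    refine ⟨?_, ih (r + 1)⟩
    have h := ev_dbeta hβ hx (r + 1) (n + 1)
    have h2 : (fbeta β)^[r + 1] x < 1 := by
      rw [Function.iterate_succ_apply']; exact Int.fract_lt_one _
    have h3 := ev_mono hβ (iter_nonneg (β := β) hx (r + 1 + (n + 1)))
      (window (dbeta β x) (r + 1) (n + 1))
    rw [← h, window_succ] at h3
    exact lt_of_le_of_lt h3 h2

/-! ### Realising sequences -/

lemma realise {β : ℝ} (hβ : 1 < β) (v : Seq)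
    (H : ∀ r m, ∃ n, m ≤ n ∧ Good β (window v r n)) :
    ∃ y ∈ Set.Icc (0 : ℝ) 1, dbeta β y = v := by
  have hβ0 : 0 < β := by linarith
  have hi0 : 0 < β⁻¹ := by positivity
  have hi1 : β⁻¹ < 1 := inv_lt_one_of_one_lt₀ hβ
  have hv : ∀ r, (v r : ℝ) ≤ β := by
    intro r
    obtain ⟨n, hn, hg⟩ := H r 1
    obtain ⟨n, rfl⟩ : ∃ n', n = n' + 1 := ⟨n - 1, by omega⟩
    rw [window_succ] at hg
    have h1 := hg.1
    rw [div_lt_one hβ0] at h1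
    have := ev_nonneg hβ zero_le_one (window v (r + 1) n)
    linarith
  have hS : Summable (fun j : ℕ => β * β⁻¹ ^ (j + 1)) :=
    Summable.mul_left _ ((summable_nat_add_iff 1).2 (summable_geometric_of_lt_one hi0.le hi1))
  have hle : ∀ r j : ℕ, (v (r + j) : ℝ) * β⁻¹ ^ (j + 1) ≤ β * β⁻¹ ^ (j + 1) := fun r j =>
    mul_le_mul_of_nonneg_right (hv _) (by positivity)
  have hs : ∀ r, Summable (fun j : ℕ => (v (r + j) : ℝ) * β⁻¹ ^ (j + 1)) := fun r =>
    Summable.of_nonneg_of_le (fun j => by positivity) (hle r) hS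
  set X : ℕ → ℝ := fun r => ∑' j : ℕ, (v (r + j) : ℝ) * β⁻¹ ^ (j + 1) with hX
  set M : ℝ := ∑' j : ℕ, β * β⁻¹ ^ (j + 1) with hM
  have hXM : ∀ r, X r ≤ M := fun r => (hs r).tsum_le_tsum (hle r) hS
  have hX0 : ∀ r, 0 ≤ X r := fun r => tsum_nonneg (fun j => by positivity)
  have hM0 : 0 ≤ M := (hX0 0).trans (hXM 0)
  have hrec : ∀ r, X r = ((v r : ℝ) + X (r + 1)) / β := by
    intro r
    have h1 := (hs r).tsum_eq_zero_add
    have h2 : ∑' j : ℕ, (v (r + (j + 1)) : ℝ) * β⁻¹ ^ (j + 1 + 1) = X (r + 1) * β⁻¹ := by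
      rw [hX]
      simp only
      rw [← tsum_mul_right]
      refine tsum_congr fun j => ?_
      rw [show r + (j + 1) = r + 1 + j by ring, pow_succ _ (j + 1)]
      ring
    rw [h2] at h1
    show ∑' j : ℕ, (v (r + j) : ℝ) * β⁻¹ ^ (j + 1) = _
    rw [h1]
    simp
    ring
  have hev : ∀ n r, X r = ev β (X (r + n)) (window v r n) := by
    intro n
    induction n with
    | zero => intro r; rfl
    | succ n ih =>
      intro r
      rw [window_succ, hrec r, ih (r + 1), show r + (n + 1) = r + 1 + n by ring]
      rfl
  have hX1 : ∀ r, X r ≤ 1 := by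
    intro r
    have key : ∀ m : ℕ, X r ≤ 1 + M * β⁻¹ ^ m := by
      intro m
      obtain ⟨n, hn, hg⟩ := H r m
      rw [hev n r, ev_eq, window_length]
      have h1 := ev_mono hβ zero_le_one (window v r n)
      have h2 := hg.ev_le
      have h3 : X (r + n) * β⁻¹ ^ n ≤ M * β⁻¹ ^ m := by
        refine mul_le_mul (hXM _) (pow_le_pow_of_le_one hi0.le hi1.le hn) (by positivity) hM0
      linarith
    have ht : Tendsto (fun m : ℕ => 1 + M * β⁻¹ ^ m) atTop (𝓝 (1 + M * 0)) :=
      ((tendsto_pow_atTop_nhds_zero_of_lt_one hi0.le hi1).const_mul M).const_add 1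
    have := ge_of_tendsto' ht key
    linarith
  have hXlt : ∀ r, X r < 1 := by
    intro r
    obtain ⟨n, hn, hg⟩ := H r 1
    rw [hev n r]
    refine lt_of_le_of_lt (ev_mono hβ (hX1 _) _) ?_
    obtain ⟨n, rfl⟩ : ∃ n', n = n' + 1 := ⟨n - 1, by omega⟩
    rw [window_succ] at hg ⊢
    exact hg.1
  have hmul : ∀ r, β * X r = (v r : ℝ) + X (r + 1) := by
    intro r
    rw [hrec r]
    field_simp
  have hfl : ∀ r, ⌊β * X r⌋₊ = v r := by
    intro r
    rw [Nat.floor_eq_iff (by have := hX0 r; positivity), hmul]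
    have := hX0 (r + 1)
    have := hXlt (r + 1)
    constructor <;> linarith
  have hit : ∀ r, (fbeta β)^[r] (X 0) = X r := by
    intro r
    induction r with
    | zero => rfl
    | succ r ih =>
      rw [Function.iterate_succ_apply', ih]
      have h1 := fbeta_step hβ (hX0 r)
      rw [hfl, hmul] at h1
      linarith
  refine ⟨X 0, ⟨hX0 0, hX1 0⟩, ?_⟩
  funext r
  unfold dbeta
  rw [hit, hfl]

/-! ### Infinite concatenations -/

/-- Concatenation of the first `j` words. -/
def Pre (W : ℕ → List ℕ) : ℕ → List ℕ
  | 0 => []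
  | j + 1 => Pre W j ++ W j

lemma Pre_mono (W : ℕ → List ℕ) {i j : ℕ} (h : i ≤ j) : Pre W i <+: Pre W j := by
  induction j, h using Nat.le_induction with
  | base => exact List.prefix_rfl
  | succ j _ ih => exact ih.trans (List.prefix_append _ _)

lemma Pre_length (W : ℕ → List ℕ) (hW : ∀ j, W j ≠ []) (j : ℕ) : j ≤ (Pre W j).length := by
  induction j with
  | zero => simp
  | succ j ih =>
    have := List.length_pos_iff.2 (hW j)
    simp only [Pre, List.length_append]
    omega

/-- The infinite concatenation. -/
def cat (W : ℕ → List ℕ) : Seq := fun r => (Pre W (r + 1)).getD r 0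

lemma cat_get (W : ℕ → List ℕ) (hW : ∀ j, W j ≠ []) (j r : ℕ) (h : r < (Pre W j).length) :
    cat W r = (Pre W j)[r] := by
  have h2 : r < (Pre W (r + 1)).length := Pre_length W hW (r + 1)
  unfold cat
  rw [List.getD_eq_getElem _ _ h2]
  rcases le_total j (r + 1) with hj | hj
  · exact ((Pre_mono W hj).getElem h).symm
  · exact (Pre_mono W hj).getElem h2

lemma window_cat (W : ℕ → List ℕ) (hW : ∀ j, W j ≠ []) (j r : ℕ) (h : r ≤ (Pre W j).length) :
    window (cat W) 0 r = (Pre W j).take r := by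
  apply List.ext_getElem
  · simp [window_length, h]
  · intro i h1 h2
    rw [window_length] at h1
    rw [List.getElem_take]
    simp only [window, List.getElem_map, List.getElem_range', zero_add, one_mul]
    exact cat_get W hW j i (by omega)

lemma good_Pre {β : ℝ} (hβ : 1 < β) (W : ℕ → List ℕ) (hG : ∀ j, Good β (W j)) (j : ℕ) :
    Good β (Pre W j) := by
  induction j with
  | zero => trivial
  | succ j ih => exact ih.append hβ (hG j)

lemma cat_good {β : ℝ} (hβ : 1 < β) (W : ℕ → List ℕ) (hW : ∀ j, W j ≠ [])
    (hG : ∀ j, Good β (W j)) (r m : ℕ) : ∃ n, m ≤ n ∧ Good β (window (cat W) r n) := by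
  have hl := Pre_length W hW (r + m)
  refine ⟨(Pre W (r + m)).length - r, by omega, ?_⟩
  have h1 := window_cat W hW (r + m) _ le_rfl
  rw [List.take_length] at h1
  have h2 := good_Pre hβ W hG (r + m)
  rw [← h1, show (Pre W (r + m)).length = r + ((Pre W (r + m)).length - r) by omega,
    window_add, zero_add] at h2
  exact h2.right

lemma count_err (l : List ℕ) (i : ℕ) {a : ℝ} (h0 : 0 ≤ a) (h1 : a ≤ 1) :
    |(l.count i : ℝ) - l.length * a| ≤ l.length := by
  have h : (l.count i : ℝ) ≤ l.length := by exact_mod_cast List.count_le_length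
  have h' : (0 : ℝ) ≤ l.count i := Nat.cast_nonneg _
  have h'' : (0 : ℝ) ≤ l.length := Nat.cast_nonneg _
  rw [abs_le]
  constructor <;> nlinarith

/-- The frequencies of a concatenation. -/
lemma cat_freq (W : ℕ → List ℕ) (hW : ∀ j, W j ≠ []) (i : ℕ) {a : ℝ} (h0 : 0 ≤ a) (h1 : a ≤ 1)
    (hf : ∀ ε > 0, ∃ J, ∀ j ≥ J, |((W j).count i : ℝ) - (W j).length * a| ≤ ε * (W j).length)
    (hl : ∀ ε > 0, ∃ J, ∀ j ≥ J, ((W j).length : ℝ) ≤ ε * j) :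
    Tendsto (fun r => (digitCount (cat W) i r : ℝ) / (r : ℝ)) atTop (𝓝 a) := by
  rw [Metric.tendsto_atTop]
  intro ε hε
  obtain ⟨J1, hJ1⟩ := hf (ε / 4) (by positivity)
  obtain ⟨J2, hJ2⟩ := hl (ε / 4) (by positivity)
  set J := max J1 J2
  set A : ℝ := |((Pre W J).count i : ℝ) - (Pre W J).length * a| with hA
  have hD : ∀ j ≥ J, |((Pre W j).count i : ℝ) - (Pre W j).length * a|
      ≤ A + ε / 4 * (Pre W j).length := by
    intro j hj
    induction j, hj using Nat.le_induction with
    | base => have : 0 ≤ ε / 4 * ((Pre W J).length : ℝ) := by positivity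
              linarith
    | succ j hj ih =>
      have h2 := hJ1 j (le_trans (le_max_left _ _) hj)
      simp only [Pre, List.count_append, List.length_append]
      push_cast
      rw [abs_le] at *
      constructor <;> linarith [ih.1, ih.2, h2.1, h2.2]
  obtain ⟨R, hR⟩ := exists_nat_gt (4 * A / ε)
  refine ⟨max (R + 1) (Pre W J).length, fun r hr => ?_⟩
  have hr1 : R + 1 ≤ r := (le_max_left _ _).trans hr
  have hr2 : (Pre W J).length ≤ r := (le_max_right _ _).trans hr
  have hex : ∃ j, r < (Pre W j).length := ⟨r + 1, Pre_length W hW (r + 1)⟩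
  obtain ⟨j, hj1, hj2, hj3⟩ : ∃ j, J ≤ j ∧ (Pre W j).length ≤ r ∧ r < (Pre W (j + 1)).length := by
    have hs := Nat.find_spec hex
    have hJf : J < Nat.find hex := by
      by_contra hc
      have := (Pre_mono W (not_lt.1 hc)).length_le
      omega
    obtain ⟨j, hj⟩ : ∃ j, Nat.find hex = j + 1 := ⟨Nat.find hex - 1, by omega⟩
    refine ⟨j, by omega, ?_, by rw [← hj]; exact hs⟩
    have := Nat.find_min hex (m := j) (by omega)
    omega
  have e1 := hD j hj1
  have e2 := hJ2 j (le_trans (le_max_right _ _) hj1)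
  have e3 := Pre_length W hW j
  have ew := window_cat W hW (j + 1) r hj3.le
  have hlen : (Pre W (j + 1)).length = (Pre W j).length + (W j).length := by simp [Pre]
  have et : (Pre W (j + 1)).take r = Pre W j ++ (W j).take (r - (Pre W j).length) := by
    simp only [Pre]
    rw [List.take_append, List.take_of_length_le hj2]
  have ec : (digitCount (cat W) i r : ℝ) = (Pre W j).count i +
      ((W j).take (r - (Pre W j).length)).count i := by
    rw [← count_window, ew, et, List.count_append]
    push_cast
    rfl
  have e4 := count_err ((W j).take (r - (Pre W j).length)) i h0 h1
  have e5 : (((W j).take (r - (Pre W j).length)).length : ℝ) = r - (Pre W j).length := by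
    rw [List.length_take, min_eq_left (by omega)]
    push_cast [hj2]
    rfl
  rw [e5] at e4
  have e6 : (r : ℝ) - (Pre W j).length ≤ (W j).length := by
    have : (r : ℝ) ≤ (Pre W j).length + (W j).length := by exact_mod_cast (by omega)
    linarith
  have hr0 : (0 : ℝ) < r := by exact_mod_cast (by omega : 0 < r)
  have e7 : (j : ℝ) ≤ r := by exact_mod_cast (by omega)
  have e8 : ((Pre W j).length : ℝ) ≤ r := by exact_mod_cast hj2
  have e9 : A < ε / 4 * r := by
    have : (R : ℝ) < r := by exact_mod_cast (by omega)
    have h3 := hR.trans this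
    rw [div_lt_iff₀ hε] at h3
    linarith
  have e10 : |(digitCount (cat W) i r : ℝ) - r * a| < ε * r := by
    have m1 : ε / 4 * (j : ℝ) ≤ ε / 4 * r := by gcongr
    have m2 : ε / 4 * ((Pre W j).length : ℝ) ≤ ε / 4 * r := by gcongr
    rw [ec]
    rw [abs_le] at e1 e4
    rw [abs_lt]
    constructor <;> nlinarith [e1.1, e1.2, e4.1, e4.2]
  rw [Real.dist_eq, show (digitCount (cat W) i r : ℝ) / r - a
    = ((digitCount (cat W) i r : ℝ) - r * a) / r by field_simp, abs_div, abs_of_pos hr0,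
    div_lt_iff₀ hr0]
  exact e10

/-! ### The approximation description of `DF(β)` -/

/-- Vectors approximable by frequencies of good words. -/
def Cset (k : ℕ) (β : ℝ) : Set (E k) :=
  {α | α ∈ simplex k ∧ ∀ ε > 0, ∃ u : List ℕ, u ≠ [] ∧ Good β u ∧
    ∀ i : Fin k, |(u.count (i : ℕ) : ℝ) - u.length * α i| ≤ ε * u.length}

lemma simplex_le_one {k : ℕ} {α : E k} (h : α ∈ simplex k) (i : Fin k) : α i ≤ 1 := by
  rw [← h.2]
  exact Finset.single_le_sum (f := fun i => α i) (fun j _ => h.1 j) (Finset.mem_univ i)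

lemma DF_sub_C {k : ℕ} {β : ℝ} (hβ : 1 < β) : DFbeta k β ⊆ Cset k β := by
  rintro α ⟨hα, x, hx, hf⟩
  refine ⟨hα, fun ε hε => ?_⟩
  have hev : ∀ i : Fin k, ∀ᶠ r : ℕ in atTop,
      |(digitCount (dbeta β x) i r : ℝ) / r - α i| < ε / 4 := by
    intro i
    have h := hf i i.2
    rw [Metric.tendsto_nhds] at h
    have h' := h (ε / 4) (by positivity)
    simpa [Real.dist_eq, proj] using h'
  have hev' := (eventually_all.2 hev).and (eventually_gt_atTop (⌈16 / ε⌉₊ + 1))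
  obtain ⟨N, hN, hN2⟩ := hev'.exists
  obtain ⟨n, rfl⟩ : ∃ n, N = n + 1 := ⟨N - 1, by omega⟩
  have hn : 16 / ε ≤ n := (Nat.le_ceil _).trans (by exact_mod_cast (by omega))
  rw [div_le_iff₀ hε] at hn
  have hn1 : (1 : ℝ) ≤ n := by exact_mod_cast (by omega)
  obtain ⟨u, hu1, hu2, hu3⟩ := adm_to_good' hβ _ (adm_dbeta hβ hx.1 0 n)
  rw [window_length] at hu2
  refine ⟨u, ?_, hu1, fun i => ?_⟩
  · rintro rfl
    simp at hu2
    omega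
  have c1 := hu3 i
  have c2 := hN i
  have c3 : (digitCount (dbeta β x) i (n + 1) : ℝ) =
      (window (dbeta β x) (0 + 1) n).count (i : ℕ) + if dbeta β x 0 = i then 1 else 0 := by
    rw [← count_window, window_succ, List.count_cons]
    push_cast
    simp
  have c4 : |(digitCount (dbeta β x) i (n + 1) : ℝ) - (n + 1) * α i| ≤ ε / 4 * (n + 1) := by
    have hp : (0 : ℝ) < (n : ℝ) + 1 := by positivity
    push_cast at c2
    rw [show (digitCount (dbeta β x) i (n + 1) : ℝ) / ((n : ℝ) + 1) - α i =
      ((digitCount (dbeta β x) i (n + 1) : ℝ) - (n + 1) * α i) / ((n : ℝ) + 1) by field_simp,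
      abs_div, abs_of_pos hp, div_lt_iff₀ hp] at c2
    exact c2.le
  have c5 := hα.1 i
  have c6 := simplex_le_one hα i
  have c7 : (0 : ℝ) ≤ (if dbeta β x 0 = (i : ℕ) then (1 : ℝ) else 0) ∧
      (if dbeta β x 0 = (i : ℕ) then (1 : ℝ) else 0) ≤ 1 := by
    split_ifs <;> norm_num
  rw [hu2]
  rw [c3] at c4
  rw [abs_le] at *
  constructor <;> nlinarith [c1.1, c1.2, c4.1, c4.2, c7.1, c7.2]

lemma C_sub_DF {k : ℕ} {β : ℝ} (hβ : 1 < β) : Cset k β ⊆ DFbeta k β := by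
  rintro α ⟨hα, hC⟩
  refine ⟨hα, ?_⟩
  have hC' : ∀ m : ℕ, ∃ u : List ℕ, u ≠ [] ∧ Good β u ∧
    ∀ i : Fin k, |(u.count (i : ℕ) : ℝ) - u.length * α i| ≤ (1 / ((m : ℝ) + 1)) * u.length :=
    fun m => hC _ (by positivity)
  choose u hu1 hu2 hu3 using hC'
  set φ : ℕ → ℕ := fun j => Nat.findGreatest (fun m => m * (u m).length ≤ j) j with hφ
  have hφs : ∀ j, φ j * (u (φ j)).length ≤ j := fun j =>
    Nat.findGreatest_spec (P := fun m => m * (u m).length ≤ j) (Nat.zero_le j) (by simp)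
  have hφt : ∀ M, ∃ J, ∀ j ≥ J, M ≤ φ j := by
    intro M
    refine ⟨max M (M * (u M).length), fun j hj => ?_⟩
    exact Nat.le_findGreatest ((le_max_left _ _).trans hj) ((le_max_right _ _).trans hj)
  set W : ℕ → List ℕ := fun j => u (φ j) with hWdef
  have hW : ∀ j, W j ≠ [] := fun j => hu1 _
  obtain ⟨y, hy, hd⟩ := realise hβ (cat W) (cat_good hβ W hW fun j => hu2 _)
  refine ⟨y, hy, fun i hi => ?_⟩
  rw [hd]
  have hp : proj α i = α ⟨i, hi⟩ := by simp [proj, hi]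
  rw [hp]
  refine cat_freq W hW i (hα.1 _) (simplex_le_one hα _) ?_ ?_
  · intro ε hε
    obtain ⟨M, hM⟩ := exists_nat_one_div_lt hε
    obtain ⟨J, hJ⟩ := hφt M
    refine ⟨J, fun j hj => (hu3 (φ j) ⟨i, hi⟩).trans ?_⟩
    have h2 : (M : ℝ) ≤ φ j := by exact_mod_cast hJ j hj
    have h3 : 1 / ((φ j : ℝ) + 1) ≤ ε := by
      refine le_trans ?_ hM.le
      gcongr
    exact mul_le_mul_of_nonneg_right h3 (Nat.cast_nonneg _)
  · intro ε hε
    obtain ⟨M, hM⟩ := exists_nat_gt (1 / ε)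
    obtain ⟨J, hJ⟩ := hφt M
    refine ⟨J, fun j hj => ?_⟩
    have h2 : (M : ℝ) ≤ φ j := by exact_mod_cast hJ j hj
    have h3 : (φ j : ℝ) * ((W j).length : ℝ) ≤ j := by exact_mod_cast hφs j
    have h4 : 1 ≤ φ j * ε := by
      have := hM.le.trans h2
      rwa [div_le_iff₀ hε] at this
    have h5 : (0 : ℝ) ≤ (W j).length := Nat.cast_nonneg _
    calc ((W j).length : ℝ) ≤ (φ j * ε) * (W j).length := le_mul_of_one_le_left h5 h4
      _ = ε * (φ j * (W j).length) := by ring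
      _ ≤ ε * j := by gcongr

lemma DF_eq_C {k : ℕ} {β : ℝ} (hβ : 1 < β) : DFbeta k β = Cset k β :=
  (DF_sub_C hβ).antisymm (C_sub_DF hβ)

lemma simplex_compact (k : ℕ) : IsCompact (simplex k) := by
  have h : simplex k = (WithLp.toLp 2) '' (stdSimplex ℝ (Fin k)) := by
    ext α
    constructor
    · intro h
      exact ⟨fun i => α i, ⟨h.1, h.2⟩, rfl⟩
    · rintro ⟨f, hf, rfl⟩
      exact ⟨hf.1, hf.2⟩
  rw [h]
  exact (isCompact_stdSimplex (𝕜 := ℝ) (Fin k)).image (PiLp.continuous_toLp 2 _)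

lemma C_compact (k : ℕ) (β : ℝ) : IsCompact (Cset k β) := by
  refine (simplex_compact k).of_isClosed_subset ?_ (fun α h => h.1)
  refine isClosed_of_closure_subset fun α hα => ?_
  have hs : α ∈ simplex k :=
    (simplex_compact k).isClosed.closure_subset_iff.2 (fun α (h : α ∈ Cset k β) => h.1) hα
  refine ⟨hs, fun ε hε => ?_⟩
  obtain ⟨γ, hγ, hd⟩ := Metric.mem_closure_iff.1 hα (ε / 2) (by positivity)
  obtain ⟨u, h1, h2, h3⟩ := hγ.2 (ε / 2) (by positivity)
  refine ⟨u, h1, h2, fun i => ?_⟩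
  have h4 : |α i - γ i| ≤ ε / 2 := by
    have := PiLp.norm_apply_le (α - γ) i
    rw [← dist_eq_norm] at this
    have h5 := this.trans hd.le
    simpa [Real.norm_eq_abs] using h5
  have h5 := h3 i
  have h6 : (0 : ℝ) ≤ u.length := Nat.cast_nonneg _
  rw [abs_le] at *
  constructor <;> nlinarith [h4.1, h4.2, h5.1, h5.2]

lemma C_convex {k : ℕ} {β : ℝ} (hβ : 1 < β) : Convex ℝ (Cset k β) := by
  intro α hα γ hγ s t hs ht hst
  have hsx : s • α + t • γ ∈ simplex k := by
    refine ⟨fun i => ?_, ?_⟩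
    · have := hα.1.1 i
      have := hγ.1.1 i
      simp only [PiLp.add_apply, PiLp.smul_apply, smul_eq_mul]
      positivity
    · simp only [PiLp.add_apply, PiLp.smul_apply, smul_eq_mul]
      rw [Finset.sum_add_distrib, ← Finset.mul_sum, ← Finset.mul_sum, hα.1.2, hγ.1.2]
      linarith
  refine ⟨hsx, fun ε hε => ?_⟩
  obtain ⟨u, u1, u2, u3⟩ := hα.2 (ε / 2) (by positivity)
  obtain ⟨v, v1, v2, v3⟩ := hγ.2 (ε / 2) (by positivity)
  obtain ⟨N, hN⟩ := exists_nat_gt (2 / ε)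
  have hN0 : (0 : ℝ) < N := lt_trans (by positivity) hN
  rw [div_lt_iff₀ hε] at hN
  have hf1 := Nat.floor_le (show 0 ≤ s * N by positivity)
  have hf2 := Nat.lt_floor_add_one (s * N)
  set p := ⌊s * N⌋₊ with hp
  have hpN : p ≤ N := by
    have : (p : ℝ) ≤ N := hf1.trans (by nlinarith)
    exact_mod_cast this
  obtain ⟨q, hq⟩ := Nat.exists_eq_add_of_le hpN
  obtain ⟨u', a1, a2, a3⟩ := u2.rep hβ (p * v.length)
  obtain ⟨v', b1, b2, b3⟩ := v2.rep hβ (q * u.length)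
  have hul := List.length_pos_iff.2 u1
  have hvl := List.length_pos_iff.2 v1
  have hlen : (u' ++ v').length = N * u.length * v.length := by
    rw [List.length_append, a2, b2, hq]; ring
  refine ⟨u' ++ v', ?_, a1.append hβ b1, fun i => ?_⟩
  · rw [← List.length_pos_iff, hlen]
    have : 0 < N := by exact_mod_cast hN0
    positivity
  rw [hlen, List.count_append, a3, b3]
  have hqr : (q : ℝ) = N - p := by rw [hq]; push_cast; ring
  have ht' : t = 1 - s := by linarith
  simp only [PiLp.add_apply, PiLp.smul_apply, smul_eq_mul]
  push_cast
  have hu0 : (0 : ℝ) < u.length := by exact_mod_cast hul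
  have hv0 : (0 : ℝ) < v.length := by exact_mod_cast hvl
  have hq0 : (0 : ℝ) ≤ q := Nat.cast_nonneg _
  have hp0 : (0 : ℝ) ≤ p := Nat.cast_nonneg _
  set x := (u.count (i : ℕ) : ℝ) - u.length * α i
  set y := (v.count (i : ℕ) : ℝ) - v.length * γ i
  have hx := u3 i
  have hy := v3 i
  have hag : |α i - γ i| ≤ 1 := by
    have := hα.1.1 i
    have := hγ.1.1 i
    have := simplex_le_one hα.1 i
    have := simplex_le_one hγ.1 i
    rw [abs_le]; constructor <;> linarith
  have hps : |(p : ℝ) - s * N| ≤ 1 := by rw [abs_le]; constructor <;> linarith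
  have hid : (p : ℝ) * v.length * (u.count (i : ℕ)) + q * u.length * (v.count (i : ℕ)) -
      N * u.length * v.length * (s * α i + t * γ i) =
      p * v.length * x + q * u.length * y +
        u.length * v.length * ((p - s * N) * (α i - γ i)) := by
    simp only [x, y]
    rw [hqr, ht']
    ring
  rw [hid]
  have k1 : |(p : ℝ) * v.length * x| ≤ p * v.length * (ε / 2 * u.length) := by
    rw [abs_mul, abs_of_nonneg (by positivity)]
    gcongr
  have k2 : |(q : ℝ) * u.length * y| ≤ q * u.length * (ε / 2 * v.length) := by
    rw [abs_mul, abs_of_nonneg (by positivity)]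
    gcongr
  have k3 : |(u.length : ℝ) * v.length * ((p - s * N) * (α i - γ i))| ≤
      u.length * v.length * (ε / 2 * N) := by
    rw [abs_mul, abs_of_nonneg (by positivity), abs_mul]
    refine mul_le_mul_of_nonneg_left ?_ (by positivity)
    calc _ ≤ (1 : ℝ) * 1 := mul_le_mul hps hag (abs_nonneg _) zero_le_one
      _ ≤ ε / 2 * N := by linarith
  refine (abs_add_le _ _).trans ((add_le_add ((abs_add_le _ _).trans (add_le_add k1 k2)) k3).trans ?_)
  rw [hqr]
  apply le_of_eq
  ring

/-- Frequency vector of a finite word. -/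
noncomputable def wfreq (k : ℕ) (u : List ℕ) : E k :=
  WithLp.toLp 2 fun i : Fin k => (u.count (i : ℕ) : ℝ) / u.length

lemma sum_count (k : ℕ) (u : List ℕ) (h : ∀ a ∈ u, a < k) :
    ∑ i : Fin k, (u.count (i : ℕ)) = u.length := by
  induction u with
  | nil => simp
  | cons a l ih =>
    simp only [List.count_cons, Finset.sum_add_distrib, List.length_cons]
    rw [ih fun b hb => h b (List.mem_cons_of_mem _ hb)]
    congr 1
    have ha := h a List.mem_cons_self
    rw [Finset.sum_eq_single (⟨a, ha⟩ : Fin k)]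
    · simp
    · intro b _ hb
      have : a ≠ b := fun hc => hb (Fin.ext hc.symm)
      simp [this]
    · simp

lemma wfreq_mem {k : ℕ} {β : ℝ} {u : List ℕ} (h0 : u ≠ []) (hu : Good β u)
    (h : ∀ a ∈ u, a < k) : wfreq k u ∈ Cset k β := by
  have hl : (0 : ℝ) < u.length := by exact_mod_cast List.length_pos_iff.2 h0
  refine ⟨⟨fun i => ?_, ?_⟩, fun ε hε => ⟨u, h0, hu, fun i => ?_⟩⟩
  · simp only [wfreq]; positivity
  · simp only [wfreq]
    rw [← Finset.sum_div, div_eq_one_iff_eq hl.ne']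
    exact_mod_cast sum_count k u h
  · simp only [wfreq]
    rw [mul_div_cancel₀ _ hl.ne', sub_self, abs_zero]
    positivity

lemma C_span (k : ℕ) (hk : 3 ≤ k) (β : ℝ) (h1 : (k : ℝ) - 1 < β) :
    (affineSpan ℝ (Cset k β) : Set (E k)) = {x : E k | ∑ i, x i = 1} := by
  have hk' : (3 : ℝ) ≤ k := by exact_mod_cast hk
  have hβ : 1 < β := by linarith
  have hβ0 : 0 < β := by linarith
  have hsingle : ∀ i : Fin k, (i : ℕ) + 1 < k →
      EuclideanSpace.single i (1 : ℝ) ∈ Cset k β := by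
    intro i hi
    have hg : Good β [(i : ℕ)] := by
      refine ⟨?_, trivial⟩
      have : ((i : ℕ) : ℝ) + 1 + 1 ≤ k := by exact_mod_cast hi
      rw [div_lt_one hβ0]
      simp only [ev]
      linarith
    have := wfreq_mem (k := k) (by simp) hg (by simp)
    convert this using 1
    ext j
    by_cases hij : j = i
    · subst hij
      simp [wfreq]
    · have : ¬ ((i : ℕ) = j) := fun hc => hij (Fin.ext hc.symm)
      simp [wfreq, List.count_cons, hij, this]
  obtain ⟨z, hz⟩ : ∃ z : Fin k, (z : ℕ) = 0 := ⟨⟨0, by omega⟩, rfl⟩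
  obtain ⟨q, hqd⟩ : ∃ q : Fin k, (q : ℕ) = k - 1 := ⟨⟨k - 1, by omega⟩, rfl⟩
  have hqz : z ≠ q := by rw [Ne, Fin.ext_iff]; omega
  have hlast : EuclideanSpace.single q (1 : ℝ) ∈ affineSpan ℝ (Cset k β) := by
    obtain ⟨N, hN⟩ := exists_pow_lt_of_lt_one (show 0 < β - (k - 1) by linarith)
      (inv_lt_one_of_one_lt₀ hβ)
    have hz0 : ∀ n, ev β 1 (List.replicate n 0) = β⁻¹ ^ n := by
      intro n
      induction n with
      | zero => simp [ev]
      | succ n ih => simp only [List.replicate_succ, ev, ih, pow_succ]; push_cast; field_simp; ring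
    have hg : Good β ((k - 1) :: List.replicate N 0) := by
      refine ⟨?_, good_zeros hβ N⟩
      rw [hz0, div_lt_one hβ0, Nat.cast_sub (by omega)]
      push_cast
      linarith
    have hm := wfreq_mem (k := k) (by simp) hg (by
      intro a ha
      rcases List.mem_cons.1 ha with rfl | ha
      · omega
      · have := List.eq_of_mem_replicate ha
        omega)
    have h0 := hsingle z (by omega)
    have hc := AffineMap.lineMap_mem (-(N : ℝ)) (subset_affineSpan ℝ _ hm)
      (subset_affineSpan ℝ _ h0)
    convert hc using 1
    ext j
    rw [AffineMap.lineMap_apply]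
    have hN1 : (N : ℝ) + 1 ≠ 0 := by positivity
    by_cases hjz : j = z
    · subst hjz
      have : ¬ (k - 1 = 0) := by omega
      simp [wfreq, hqz, hz, this, List.count_cons]
      field_simp
      ring
    · by_cases hjq : j = q
      · subst hjq
        have : ¬ (0 = k - 1) := by omega
        simp [wfreq, hjz, hqd, List.count_cons, List.count_replicate, this]
        field_simp
      · have e1 : ¬ (k - 1 = (j : ℕ)) := fun hc => hjq (Fin.ext (hqd.trans hc).symm)
        have e2 : ¬ (0 = (j : ℕ)) := fun hc => hjz (Fin.ext (hz.trans hc).symm)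
        simp [wfreq, hjz, hjq, List.count_cons, List.count_replicate, e1, e2]
  have hall : ∀ i : Fin k, EuclideanSpace.single i (1 : ℝ) ∈ affineSpan ℝ (Cset k β) := by
    intro i
    by_cases hi : (i : ℕ) + 1 < k
    · exact subset_affineSpan ℝ _ (hsingle i hi)
    · have : i = q := by apply Fin.ext; have := i.2; omega
      rw [this]; exact hlast
  apply Set.Subset.antisymm
  · intro x hx
    have hx' : x ∈ affineSpan ℝ (Cset k β) := hx
    refine affineSpan_induction (p := fun x : E k => ∑ i, x i = 1) hx' (fun y hy => hy.1.2) ?_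
    intro c u v w hu hv hw
    simp only [vsub_eq_sub, vadd_eq_add, PiLp.add_apply, PiLp.smul_apply, PiLp.sub_apply,
      smul_eq_mul, Finset.sum_add_distrib, ← Finset.mul_sum, Finset.sum_sub_distrib, hu, hv, hw]
    ring
  · intro x hx
    have hx' : ∑ i, x i = 1 := hx
    have h3 := affineCombination_mem_affineSpan (k := ℝ) (s := Finset.univ) (w := fun i => x i) hx'
      (fun i : Fin k => (EuclideanSpace.single i (1 : ℝ) : E k))
    rw [Finset.affineCombination_eq_linear_combination _ _ _ hx'] at h3
    have h4 : ∑ i, x i • (EuclideanSpace.single i (1 : ℝ) : E k) = x := by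
      ext j
      simp [Pi.single_apply]
    rw [h4] at h3
    refine (affineSpan_le.2 ?_) h3
    rintro _ ⟨i, rfl⟩
    exact hall i

/-- for `k ≥ 3` and `β ∈ (k−1,k)`, `DF(β)` is a compact convex subset of `Δ`
of dimension `k−1`: its affine hull is the hyperplane `{x : ∑ xᵢ = 1}`. -/
theorem stmt12 (k : ℕ) (hk : 3 ≤ k) (β : ℝ) (h1 : (k : ℝ) - 1 < β) (h2 : β < k) :
    IsCompact (DFbeta k β) ∧ Convex ℝ (DFbeta k β) ∧
    (affineSpan ℝ (DFbeta k β) : Set (E k)) = {x : E k | ∑ i, x i = 1} := by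
  have hk' : (3 : ℝ) ≤ k := by exact_mod_cast hk
  have hβ : 1 < β := by linarith
  rw [DF_eq_C hβ]
  exact ⟨C_compact k β, C_convex hβ, C_span k hk β h1⟩

end BetaDF
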